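/- arXiv:2011.00981 — 8 statements merged into one kernel-verified Lean document; each statement's English description precedes it below -/
import Mathlib

section
/- Fix a panel dataset, an integer q ≥ 1, β ∈ ℝ^d, and ρ ∈ ℝ^q with ‖ρ‖₂² ≤ 1. Then for every (i,t) ∈ [N]×[T], the GLSE sub-function is bounded by twice the sum of the corresponding OLSE sub-functions: ψ^{G,q}_{it}(β,ρ) ≤ 2·(ψ^O_{it}(β) + Σ_{j=1}^{min{t−1,q}} ψ^O_{i,t−j}(β)). -/
/-- The OLSE sub-function `ψ^O_{it}(β) = (y_{it} − ⟨x_{it}, β⟩)²`. -/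
noncomputable def psiO {N T d : ℕ} (x : Fin N → Fin T → Fin d → ℝ) (y : Fin N → Fin T → ℝ)
    (i : Fin N) (t : Fin T) (β : Fin d → ℝ) : ℝ :=
  (y i t - ∑ j, x i t j * β j) ^ 2

/-- The GLSE sub-function `ψ^{G,q}_{it}(β,ρ)` (time periods are 0-indexed: `t = 0` plays
the role of the first time period, and `ρ a` is `ρ_{a+1}` of the paper). -/
noncomputable def psiG {N T d q : ℕ} (x : Fin N → Fin T → Fin d → ℝ) (y : Fin N → Fin T → ℝ)
    (i : Fin N) (t : Fin T) (β : Fin d → ℝ) (ρ : Fin q → ℝ) : ℝ :=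
  if (t : ℕ) = 0 then
    (1 - ∑ a, ρ a ^ 2) * (y i t - ∑ j, x i t j * β j) ^ 2
  else
    ((y i t - ∑ j, x i t j * β j) -
      ∑ a : Fin q, if h : (a : ℕ) < (t : ℕ) then
        ρ a * (y i ⟨(t : ℕ) - (a : ℕ) - 1, by have := t.isLt; omega⟩ -
          ∑ j, x i ⟨(t : ℕ) - (a : ℕ) - 1, by have := t.isLt; omega⟩ j * β j)
      else 0) ^ 2

/-- Cauchy–Schwarz bound for a residual corrected by a combination with coefficients in the
Euclidean unit ball. -/
theorem sq_sub_sum_mul_le {ι : Type*} (s : Finset ι) (e : ℝ) (r z : ι → ℝ)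
    (hr : ∑ a ∈ s, r a ^ 2 ≤ 1) :
    (e - ∑ a ∈ s, r a * z a) ^ 2 ≤ 2 * (e ^ 2 + ∑ a ∈ s, z a ^ 2) := by
  have hcs := Finset.sum_mul_sq_le_sq_mul_sq s r z
  have hz : 0 ≤ ∑ a ∈ s, z a ^ 2 := Finset.sum_nonneg fun a _ => sq_nonneg (z a)
  have hle := mul_le_mul_of_nonneg_right hr hz
  linarith [sq_nonneg (e + ∑ a ∈ s, r a * z a)]

/-- the GLSE sub-function is bounded by twice the sum of the corresponding
OLSE sub-functions, `ψ^{G,q}_{it}(β,ρ) ≤ 2·(ψ^O_{it}(β) + Σ_{j=1}^{min{t−1,q}} ψ^O_{i,t−j}(β))`. -/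
theorem glse_subfunction_le_two_olse
    (N T d q : ℕ) (hq : 1 ≤ q)
    (x : Fin N → Fin T → Fin d → ℝ) (y : Fin N → Fin T → ℝ)
    (β : Fin d → ℝ) (ρ : Fin q → ℝ) (hρ : ∑ a, ρ a ^ 2 ≤ 1) :
    ∀ (i : Fin N) (t : Fin T),
      psiG x y i t β ρ ≤
        2 * (psiO x y i t β +
          ∑ a : Fin q, if h : (a : ℕ) < (t : ℕ) then
            psiO x y i ⟨(t : ℕ) - (a : ℕ) - 1, by have := t.isLt; omega⟩ β
          else 0) := by
  intro i t
  have hsum : 0 ≤ ∑ a, ρ a ^ 2 := Finset.sum_nonneg fun a _ => sq_nonneg (ρ a)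
  by_cases ht : (t : ℕ) = 0
  · simp only [psiG, psiO, ht, if_true, Nat.not_lt_zero, dite_false, Finset.sum_const_zero]
    linarith [mul_nonneg hsum (sq_nonneg (y i t - ∑ j, x i t j * β j)),
      sq_nonneg (y i t - ∑ j, x i t j * β j)]
  · rw [psiG, if_neg ht]
    convert sq_sub_sum_mul_le Finset.univ (y i t - ∑ j, x i t j * β j) ρ
      (fun a : Fin q => if h : (a : ℕ) < (t : ℕ) then
        y i ⟨(t : ℕ) - (a : ℕ) - 1, by have := t.isLt; omega⟩ -
          ∑ j, x i ⟨(t : ℕ) - (a : ℕ) - 1, by have := t.isLt; omega⟩ j * β j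
      else 0) hρ using 5 with a _ a
    · split_ifs <;> simp
    · rfl
    · split_ifs <;> simp [psiO]
end

section
/- Fix a panel dataset, integers q ≥ 1 and k ≥ 1, vectors β^{(1)},…,β^{(k)} ∈ ℝ^d, and vectors ρ^{(1)},…,ρ^{(k)} ∈ ℝ^q each with ‖ρ^{(l)}‖₂² ≤ 1. Then for every individual i ∈ [N], the GLSE_k individual objective satisfies ψ^{G,q,k}_i(ζ) = min_{l∈[k]} ψ^{G,q}_i(β^{(l)},ρ^{(l)}) ≤ 2(q+1) · min_{l∈[k]} ψ^O_i(β^{(l)}). -/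
/-- The squares of a sequence shifted by `a + 1` places sum to at most the sum of all squares. -/
theorem sum_sq_shift_le {T : ℕ} (e : Fin T → ℝ) (a : ℕ) :
    ∑ t : Fin T, (if a < (t : ℕ) then
      e ⟨(t : ℕ) - a - 1, by have := t.isLt; omega⟩ else 0) ^ 2 ≤ ∑ t, e t ^ 2 := by
  classical
  let g : Fin T → Fin T := fun t => ⟨(t : ℕ) - a - 1, by have := t.isLt; omega⟩
  have hg : Set.InjOn g (Finset.univ.filter fun t : Fin T => a < (t : ℕ)) := by
    intro s hs t ht hst
    simp only [Finset.coe_filter, Finset.mem_univ, true_and, Set.mem_ofPred_eq] at hs ht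
    have := congrArg Fin.val hst
    simp only [g] at this
    ext
    omega
  calc _ = ∑ t ∈ Finset.univ.filter (fun t : Fin T => a < (t : ℕ)), e (g t) ^ 2 := by
        simp only [Finset.sum_filter, g, ite_pow, zero_pow two_ne_zero]
    _ = ∑ s ∈ (Finset.univ.filter fun t : Fin T => a < (t : ℕ)).image g, e s ^ 2 :=
        (Finset.sum_image (f := fun s => e s ^ 2) hg).symm
    _ ≤ _ := Finset.sum_le_sum_of_subset_of_nonneg (Finset.subset_univ _)
        fun _ _ _ => sq_nonneg _

/-- The GLSE sub-function is controlled by the current squared residual and the `q` lagged ones. -/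
theorem psiG_le {N T d q : ℕ} (x : Fin N → Fin T → Fin d → ℝ) (y : Fin N → Fin T → ℝ)
    (i : Fin N) (t : Fin T) (β : Fin d → ℝ) (ρ : Fin q → ℝ) (hρ : ∑ a, ρ a ^ 2 ≤ 1) :
    psiG x y i t β ρ ≤ 2 * psiO x y i t β +
      2 * ∑ a : Fin q, (if (a : ℕ) < (t : ℕ) then
        (fun s => y i s - ∑ j, x i s j * β j)
          ⟨(t : ℕ) - (a : ℕ) - 1, by have := t.isLt; omega⟩ else 0) ^ 2 := by
  set f : Fin q → ℝ := fun a => if (a : ℕ) < (t : ℕ) then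
    (fun s => y i s - ∑ j, x i s j * β j)
      ⟨(t : ℕ) - (a : ℕ) - 1, by have := t.isLt; omega⟩ else 0 with hf
  have hf0 : 0 ≤ ∑ a, f a ^ 2 := Finset.sum_nonneg fun _ _ => sq_nonneg _
  change _ ≤ _ + 2 * ∑ a, f a ^ 2
  have hρ0 : 0 ≤ ∑ a, ρ a ^ 2 := Finset.sum_nonneg fun _ _ => sq_nonneg _
  unfold psiG psiO
  split_ifs with ht
  · nlinarith [sq_nonneg (y i t - ∑ j, x i t j * β j),
      mul_nonneg hρ0 (sq_nonneg (y i t - ∑ j, x i t j * β j))]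
  · have hsum : (∑ a : Fin q, if h : (a : ℕ) < (t : ℕ) then
        ρ a * (y i ⟨(t : ℕ) - (a : ℕ) - 1, by have := t.isLt; omega⟩ -
          ∑ j, x i ⟨(t : ℕ) - (a : ℕ) - 1, by have := t.isLt; omega⟩ j * β j)
        else 0) = ∑ a, ρ a * f a := by
      refine Finset.sum_congr rfl fun a _ => ?_
      by_cases h : (a : ℕ) < (t : ℕ) <;> simp [hf, h]
    rw [hsum]
    have hcs := Finset.sum_mul_sq_le_sq_mul_sq Finset.univ ρ f
    have hle := mul_le_mul_of_nonneg_right hρ hf0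
    nlinarith [sq_nonneg ((y i t - ∑ j, x i t j * β j) + ∑ a, ρ a * f a)]

/-- The individual GLSE objective is at most `2 (q + 1)` times the individual OLSE objective. -/
theorem sum_psiG_le {N T d q : ℕ} (x : Fin N → Fin T → Fin d → ℝ) (y : Fin N → Fin T → ℝ)
    (i : Fin N) (β : Fin d → ℝ) (ρ : Fin q → ℝ) (hρ : ∑ a, ρ a ^ 2 ≤ 1) :
    ∑ t, psiG x y i t β ρ ≤ 2 * ((q : ℝ) + 1) * ∑ t, psiO x y i t β := by
  refine (Finset.sum_le_sum fun t _ => psiG_le x y i t β ρ hρ).trans ?_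
  rw [Finset.sum_add_distrib, ← Finset.mul_sum, ← Finset.mul_sum, Finset.sum_comm]
  have h := Finset.sum_le_sum fun (a : Fin q) (_ : a ∈ Finset.univ) =>
    sum_sq_shift_le (fun s => y i s - ∑ j, x i s j * β j) a
  rw [Finset.sum_const, Finset.card_univ, Fintype.card_fin, nsmul_eq_mul] at h
  change _ ≤ (q : ℝ) * ∑ t, psiO x y i t β at h
  linarith

/-- the GLSE_k individual objective
`ψ^{G,q,k}_i(ζ) = min_{l∈[k]} ψ^{G,q}_i(β^{(l)}, ρ^{(l)})` is at most
`2(q+1) · min_{l∈[k]} ψ^O_i(β^{(l)})`. -/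
theorem glsek_individual_le_olsek
    (N T d q k : ℕ) (hq : 1 ≤ q) (hk : 1 ≤ k)
    (x : Fin N → Fin T → Fin d → ℝ) (y : Fin N → Fin T → ℝ)
    (β : Fin k → Fin d → ℝ) (ρ : Fin k → Fin q → ℝ)
    (hρ : ∀ l, ∑ a, ρ l a ^ 2 ≤ 1) :
    ∀ i : Fin N,
      Finset.univ.inf' ⟨⟨0, hk⟩, Finset.mem_univ _⟩
          (fun l => ∑ t, psiG x y i t (β l) (ρ l)) ≤
        2 * ((q : ℝ) + 1) *
          Finset.univ.inf' ⟨⟨0, hk⟩, Finset.mem_univ _⟩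
            (fun l => ∑ t, psiO x y i t (β l)) := by
  intro i
  obtain ⟨l, hl, heq⟩ := Finset.exists_mem_eq_inf' (s := Finset.univ)
    ⟨⟨0, hk⟩, Finset.mem_univ _⟩ (fun l : Fin k => ∑ t, psiO x y i t (β l))
  rw [heq]
  exact (Finset.inf'_le _ hl).trans (sum_psiG_le x y i (β l) (ρ l) (hρ l))
end

section
/- Let Z^{(1)},…,Z^{(N)} be real T×(d+1) matrices; for each i let u_i be the largest eigenvalue and ℓ_i the smallest eigenvalue of (Z^{(i)})ᵀZ^{(i)}, and assume ℓ_i > 0 for every i. Then for every i ∈ [N], k ≥ 1, and all β^{(1)},…,β^{(k)} ∈ ℝ^d (with v_l = (β^{(l)},−1)), the denominator Σ_{i'∈[N]} min_{l∈[k]} ‖Z^{(i')} v_l‖₂² is positive and min_{l∈[k]} ‖Z^{(i)} v_l‖₂² / Σ_{i'∈[N]} min_{l∈[k]} ‖Z^{(i')} v_l‖₂² ≤ u_i / (u_i + Σ_{i'≠i} ℓ_{i'}). -/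
open Matrix

/-- If a positive function `w` controls `f i'` from below by `ℓ i' * w` for all `i'` and `f i` from
above by `u * w`, then the share of `i` in the sum of the minima is at most
`u / (u + ∑ i' ≠ i, ℓ i')`. -/
theorem inf'_div_sum_inf'_le {ι κ : Type*} [Fintype ι] [DecidableEq ι] {s : Finset κ}
    (hs : s.Nonempty) (f : ι → κ → ℝ) (w : κ → ℝ) (u : ℝ) (ℓ : ι → ℝ) (i : ι)
    (hw : ∀ l ∈ s, 0 < w l) (hu : ∀ l ∈ s, f i l ≤ u * w l)
    (hl : ∀ i', ∀ l ∈ s, ℓ i' * w l ≤ f i' l) (hlpos : ∀ i', 0 < ℓ i') :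
    0 < ∑ i', s.inf' hs (f i') ∧
      s.inf' hs (f i) / ∑ i', s.inf' hs (f i') ≤
        u / (u + ∑ i' ∈ Finset.univ.erase i, ℓ i') := by
  obtain ⟨l₀, hl₀, hmin⟩ := s.exists_min_image w hs
  have hm : 0 < w l₀ := hw l₀ hl₀
  have hlow (i' : ι) : ℓ i' * w l₀ ≤ s.inf' hs (f i') :=
    Finset.le_inf' _ _ fun l h =>
      (mul_le_mul_of_nonneg_left (hmin l h) (hlpos i').le).trans (hl i' l h)
  have hup : s.inf' hs (f i) ≤ u * w l₀ := (Finset.inf'_le _ hl₀).trans (hu l₀ hl₀)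
  have hpos (i' : ι) : 0 < s.inf' hs (f i') := (mul_pos (hlpos i') hm).trans_le (hlow i')
  have hu0 : 0 < u := pos_of_mul_pos_left ((hpos i).trans_le hup) hm.le
  have hL : 0 ≤ ∑ i' ∈ Finset.univ.erase i, ℓ i' := Finset.sum_nonneg fun i' _ => (hlpos i').le
  have hB : (∑ i' ∈ Finset.univ.erase i, ℓ i') * w l₀ ≤
      ∑ i' ∈ Finset.univ.erase i, s.inf' hs (f i') := by
    rw [Finset.sum_mul]
    exact Finset.sum_le_sum fun i' _ => hlow i'
  have hsum : 0 < ∑ i', s.inf' hs (f i') :=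
    Finset.sum_pos (fun i' _ => hpos i') ⟨i, Finset.mem_univ i⟩
  refine ⟨hsum, ?_⟩
  rw [div_le_div_iff₀ hsum (by linarith), ← Finset.add_sum_erase _ _ (Finset.mem_univ i)]
  linarith [mul_le_mul_of_nonneg_right hup hL, mul_le_mul_of_nonneg_left hB hu0.le]

/-- sensitivity bound for OLSE_k. If for each `i`, `u i` is the largest
eigenvalue of `(Z⁽ⁱ⁾)ᵀZ⁽ⁱ⁾` (i.e. `‖Z⁽ⁱ⁾v‖₂² ≤ u i · ‖v‖₂²` for all `v`) and `ℓ i > 0` is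
the smallest eigenvalue (i.e. `ℓ i · ‖v‖₂² ≤ ‖Z⁽ⁱ⁾v‖₂²` for all `v`), then for every `i`
and all `β^{(1)},…,β^{(k)}` (with `v_l = (β^{(l)}, −1)`), the denominator
`Σ_{i'} min_l ‖Z⁽ⁱ'⁾ v_l‖₂²` is positive and
`min_l ‖Z⁽ⁱ⁾ v_l‖₂² / Σ_{i'} min_l ‖Z⁽ⁱ'⁾ v_l‖₂² ≤ u i / (u i + Σ_{i'≠i} ℓ i')`. -/
theorem olsek_sensitivity_bound
    (T d k N : ℕ) (hk : 1 ≤ k)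
    (Z : Fin N → Matrix (Fin T) (Fin (d + 1)) ℝ) (u ℓ : Fin N → ℝ)
    (hu : ∀ (i : Fin N) (v : Fin (d + 1) → ℝ),
      ∑ t, ((Z i).mulVec v t) ^ 2 ≤ u i * ∑ a, v a ^ 2)
    (hl : ∀ (i : Fin N) (v : Fin (d + 1) → ℝ),
      ℓ i * ∑ a, v a ^ 2 ≤ ∑ t, ((Z i).mulVec v t) ^ 2)
    (hlpos : ∀ i, 0 < ℓ i)
    (i : Fin N) (β : Fin k → Fin d → ℝ) :
    0 < (∑ i', Finset.univ.inf' ⟨⟨0, hk⟩, Finset.mem_univ _⟩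
          (fun l => ∑ t, ((Z i').mulVec (Fin.snoc (β l) (-1)) t) ^ 2)) ∧
    (Finset.univ.inf' ⟨⟨0, hk⟩, Finset.mem_univ _⟩
          (fun l => ∑ t, ((Z i).mulVec (Fin.snoc (β l) (-1)) t) ^ 2)) /
        (∑ i', Finset.univ.inf' ⟨⟨0, hk⟩, Finset.mem_univ _⟩
          (fun l => ∑ t, ((Z i').mulVec (Fin.snoc (β l) (-1)) t) ^ 2)) ≤
      u i / (u i + ∑ i' ∈ Finset.univ.erase i, ℓ i') := by
  refine inf'_div_sum_inf'_le _
    (fun i' l => ∑ t, ((Z i').mulVec (Fin.snoc (β l) (-1)) t) ^ 2)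
    (fun l => ∑ a, (Fin.snoc (β l) (-1) : Fin (d + 1) → ℝ) a ^ 2) (u i) ℓ i
    (fun l _ => ?_) (fun l _ => hu i _) (fun i' l _ => hl i' _) hlpos
  rw [Fin.sum_univ_castSucc]
  simp only [Fin.snoc_castSucc, Fin.snoc_last]
  positivity
end

section
/- Let N ≥ 1 and for each j ∈ [N] set x_j = (4^j, 4^{−j}) ∈ ℝ². For β¹, β² ∈ ℝ² define f_j(β¹,β²) = min(⟨x_j,β¹⟩², ⟨x_j,β²⟩²). Then for every i ∈ [N] there exist β¹, β² ∈ ℝ² (namely β¹ = (4^{−i},0), β² = (0,4^i)) such that Σ_{j∈[N]} f_j(β¹,β²) > 0 and f_i(β¹,β²) ≥ (1/2)·Σ_{j∈[N]} f_j(β¹,β²). Consequently, the total sensitivity Σ_{i∈[N]} sup_{β¹,β²} f_i(β¹,β²)/Σ_{j∈[N]} f_j(β¹,β²) is at least N/2. -/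
/-- The lower-bound instance: `x_j = (4^j, 4^{−j}) ∈ ℝ²`. -/
noncomputable def xLB (j : ℕ) : Fin 2 → ℝ := ![(4 : ℝ) ^ (j : ℤ), (4 : ℝ) ^ (-(j : ℤ))]

/-- The GLSE_k individual objective on the lower-bound instance (`T = 1`, `d = k = 2`,
`y_{j1} = 0`): `f_j(β¹,β²) = min(⟨x_j,β¹⟩², ⟨x_j,β²⟩²)`. -/
noncomputable def fLB (j : ℕ) (β1 β2 : Fin 2 → ℝ) : ℝ :=
  min ((∑ a, xLB j a * β1 a) ^ 2) ((∑ a, xLB j a * β2 a) ^ 2)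

theorem fLB_nonneg (j : ℕ) (β1 β2 : Fin 2 → ℝ) : 0 ≤ fLB j β1 β2 :=
  le_min (sq_nonneg _) (sq_nonneg _)

theorem fLB_axis (i j : ℕ) :
    fLB j ![(4 : ℝ) ^ (-(i : ℤ)), 0] ![0, (4 : ℝ) ^ (i : ℤ)] =
      min ((16 : ℝ) ^ ((j : ℤ) - i)) ((16 : ℝ) ^ ((i : ℤ) - j)) := by
  have sq_zpow (n : ℤ) : ((4 : ℝ) ^ n) ^ 2 = 16 ^ n := by
    rw [show (16 : ℝ) = 4 * 4 by norm_num, mul_zpow, sq]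
  have h4 : (4 : ℝ) ≠ 0 := by norm_num
  simp only [fLB, xLB, Fin.sum_univ_two, Matrix.cons_val_zero, Matrix.cons_val_one, mul_zero,
    add_zero, zero_add, ← zpow_add₀ h4, sq_zpow]
  congr 2
  ring

theorem sum_fLB_axis_le_zpow (i n : ℕ) :
    ∑ j ∈ Finset.Icc 1 n, fLB j ![(4 : ℝ) ^ (-(i : ℤ)), 0] ![0, (4 : ℝ) ^ (i : ℤ)] ≤
      16 / 15 * (16 : ℝ) ^ ((n : ℤ) - i) := by
  induction n with
  | zero => simp
  | succ n ih =>
    rw [Finset.sum_Icc_succ_top (by omega), fLB_axis i (n + 1)]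
    have hmin := min_le_left ((16 : ℝ) ^ (((n + 1 : ℕ) : ℤ) - i)) (16 ^ ((i : ℤ) - (n + 1 : ℕ)))
    have hpow : (16 : ℝ) ^ (((n + 1 : ℕ) : ℤ) - i) = 16 ^ ((n : ℤ) - i) * 16 := by
      rw [← zpow_add_one₀ (by norm_num)]
      congr 1
      push_cast
      ring
    linarith

theorem sum_fLB_axis_le_sub (i k : ℕ) :
    ∑ j ∈ Finset.Icc 1 (i + k), fLB j ![(4 : ℝ) ^ (-(i : ℤ)), 0] ![0, (4 : ℝ) ^ (i : ℤ)] ≤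
      17 / 15 - 1 / 15 * (16 : ℝ) ^ (-(k : ℤ)) := by
  induction k with
  | zero =>
    have h := sum_fLB_axis_le_zpow i i
    norm_num at h ⊢
    exact h
  | succ k ih =>
    rw [← add_assoc, Finset.sum_Icc_succ_top (by omega), fLB_axis i (i + k + 1)]
    have hmin := min_le_right ((16 : ℝ) ^ (((i + k + 1 : ℕ) : ℤ) - i))
      (16 ^ ((i : ℤ) - (i + k + 1 : ℕ)))
    have hexp : (i : ℤ) - (i + k + 1 : ℕ) = -((k + 1 : ℕ) : ℤ) := by
      push_cast
      ring
    have hpow : (16 : ℝ) ^ (-(k : ℤ)) = 16 ^ (-((k + 1 : ℕ) : ℤ)) * 16 := by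
      rw [← zpow_add_one₀ (by norm_num)]
      congr 1
      push_cast
      ring
    rw [hexp] at hmin ⊢
    linarith

theorem exists_half_sum_fLB_le {N i : ℕ} (hi : i ∈ Finset.Icc 1 N) :
    ∃ β1 β2 : Fin 2 → ℝ, 0 < ∑ j ∈ Finset.Icc 1 N, fLB j β1 β2 ∧
      (1 / 2) * ∑ j ∈ Finset.Icc 1 N, fLB j β1 β2 ≤ fLB i β1 β2 := by
  refine ⟨![(4 : ℝ) ^ (-(i : ℤ)), 0], ![0, (4 : ℝ) ^ (i : ℤ)], ?_, ?_⟩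
  · refine Finset.sum_pos (fun j _ => ?_) ⟨i, hi⟩
    rw [fLB_axis]
    positivity
  · obtain ⟨k, rfl⟩ := Nat.exists_eq_add_of_le (Finset.mem_Icc.mp hi).2
    have hsum := sum_fLB_axis_le_sub i k
    have hpos : (0 : ℝ) < 16 ^ (-(k : ℤ)) := by positivity
    have hone : fLB i ![(4 : ℝ) ^ (-(i : ℤ)), 0] ![0, (4 : ℝ) ^ (i : ℤ)] = 1 := by
      rw [fLB_axis]
      simp
    rw [hone]
    linarith

/-- on the lower-bound instance, every individual `i ∈ [N]` has sensitivity at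
least `1/2` (witnessed by `β¹ = (4^{−i},0)`, `β² = (0,4^i)`), and consequently the total
sensitivity is at least `N/2`. -/
theorem glsek_total_sensitivity_lower_bound (N : ℕ) (hN : 1 ≤ N) :
    (∀ i ∈ Finset.Icc 1 N, ∃ β1 β2 : Fin 2 → ℝ,
        0 < ∑ j ∈ Finset.Icc 1 N, fLB j β1 β2 ∧
        (1 / 2) * ∑ j ∈ Finset.Icc 1 N, fLB j β1 β2 ≤ fLB i β1 β2) ∧
    (N : ℝ) / 2 ≤ ∑ i ∈ Finset.Icc 1 N,
        sSup {r : ℝ | ∃ β1 β2 : Fin 2 → ℝ,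
          0 < ∑ j ∈ Finset.Icc 1 N, fLB j β1 β2 ∧
          r = fLB i β1 β2 / ∑ j ∈ Finset.Icc 1 N, fLB j β1 β2} := by
  refine ⟨fun i hi => exists_half_sum_fLB_le hi, ?_⟩
  calc (N : ℝ) / 2 = ∑ _i ∈ Finset.Icc 1 N, (1 / 2 : ℝ) := by simp [div_eq_mul_inv]
    _ ≤ _ := Finset.sum_le_sum fun i hi => ?_
  obtain ⟨β1, β2, hpos, hle⟩ := exists_half_sum_fLB_le hi
  refine le_csSup_of_le ⟨1, ?_⟩ ⟨β1, β2, hpos, rfl⟩ ((le_div_iff₀ hpos).mpr hle)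
  rintro r ⟨γ1, γ2, hγ, rfl⟩
  exact (div_le_one₀ hγ).mpr
    (Finset.single_le_sum (f := fun j => fLB j γ1 γ2) (fun j _ => fLB_nonneg j γ1 γ2) hi)
end

section
/- Let N ≥ 1, x_j = (4^j, 4^{−j}) ∈ ℝ² for j ∈ [N], and f_j(β¹,β²) = min(⟨x_j,β¹⟩², ⟨x_j,β²⟩²). Suppose S ⊆ [N] and w : S → ℝ_{≥0} satisfy, for all β¹, β² ∈ ℝ², (1/2)·Σ_{j∈[N]} f_j(β¹,β²) ≤ Σ_{i∈S} w(i)·f_i(β¹,β²) ≤ (3/2)·Σ_{j∈[N]} f_j(β¹,β²). Then for every i ∈ S one has w(i) < 2. -/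
/-- With `β¹ = (4^{-i}, 0)` and `β² = (0, 4^i)` the objective decays geometrically in `|j - i|`. -/
theorem fLB_peak (i j : ℕ) :
    fLB j ![((4 : ℝ) ^ i)⁻¹, 0] ![0, (4 : ℝ) ^ i] = (1 / 16 : ℝ) ^ ((i - j) + (j - i)) := by
  have key (m : ℕ) : ((4 : ℝ) ^ m) ^ 2 = 16 ^ m := by
    rw [← pow_mul, mul_comm, pow_mul]; norm_num
  have hm (m : ℕ) : ((16 : ℝ) ^ m)⁻¹ ≤ 16 ^ m :=
    (inv_le_one_of_one_le₀ (one_le_pow₀ (by norm_num))).trans (one_le_pow₀ (by norm_num))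
  rcases le_total i j with h | h
  · obtain ⟨m, rfl⟩ := Nat.exists_eq_add_of_le h
    have h1 : (4 : ℝ) ^ (i + m) * (4 ^ i)⁻¹ = 4 ^ m := by field_simp; ring
    have h2 : ((4 : ℝ) ^ (i + m))⁻¹ * 4 ^ i = (4 ^ m)⁻¹ := by field_simp; ring
    simp only [fLB, xLB, Fin.sum_univ_two, Matrix.cons_val_zero, Matrix.cons_val_one, mul_zero,
      add_zero, zero_add, zpow_neg, zpow_natCast, h1, h2, inv_pow, key]
    rw [min_eq_right (hm m)]
    simp
  · obtain ⟨m, rfl⟩ := Nat.exists_eq_add_of_le h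
    have h1 : (4 : ℝ) ^ j * (4 ^ (j + m))⁻¹ = (4 ^ m)⁻¹ := by field_simp; ring
    have h2 : ((4 : ℝ) ^ j)⁻¹ * 4 ^ (j + m) = 4 ^ m := by field_simp; ring
    simp only [fLB, xLB, Fin.sum_univ_two, Matrix.cons_val_zero, Matrix.cons_val_one, mul_zero,
      add_zero, zero_add, zpow_neg, zpow_natCast, h1, h2, inv_pow, key]
    rw [min_eq_left (hm m)]
    simp

theorem geom_sum_sixteenth_le (m : ℕ) :
    ∑ k ∈ Finset.range m, (1 / 16 : ℝ) ^ k ≤ 16 / 15 := by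
  rw [geom_sum_eq (by norm_num), div_le_iff_of_neg (by norm_num)]
  have : (0 : ℝ) ≤ (1 / 16) ^ m := by positivity
  linarith

theorem sum_two_sided_geom_le (i N : ℕ) :
    ∑ j ∈ Finset.Icc 1 N, (1 / 16 : ℝ) ^ ((i - j) + (j - i)) ≤ 17 / 15 := by
  have hsub : Finset.Icc 1 N ⊆ Finset.range (i + 1 + N) := by
    intro j hj
    simp only [Finset.mem_Icc, Finset.mem_range] at hj ⊢
    omega
  refine (Finset.sum_le_sum_of_subset_of_nonneg hsub fun _ _ _ => by positivity).trans ?_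
  rw [Finset.sum_range_add]
  have left : ∑ j ∈ Finset.range (i + 1), (1 / 16 : ℝ) ^ ((i - j) + (j - i)) ≤ 16 / 15 := by
    rw [← Finset.sum_range_reflect]
    refine le_trans (le_of_eq (Finset.sum_congr rfl fun j hj => ?_)) (geom_sum_sixteenth_le (i + 1))
    rw [Finset.mem_range] at hj
    congr 1
    omega
  have right : ∑ k ∈ Finset.range N, (1 / 16 : ℝ) ^ ((i - (i + 1 + k)) + (i + 1 + k - i))
      = 1 / 16 * ∑ k ∈ Finset.range N, (1 / 16 : ℝ) ^ k := by
    rw [Finset.mul_sum]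
    refine Finset.sum_congr rfl fun k _ => ?_
    rw [← pow_succ']
    congr 1
    omega
  linarith [geom_sum_sixteenth_le N]

/-- every weight of a 0.5-coreset on the lower-bound instance is below 2. -/
theorem glsek_coreset_weights_lt_two
    (N : ℕ) (hN : 1 ≤ N) (S : Finset ℕ) (hS : S ⊆ Finset.Icc 1 N)
    (w : ℕ → ℝ) (hw : ∀ i ∈ S, 0 ≤ w i)
    (hcore : ∀ β1 β2 : Fin 2 → ℝ,
      (1 / 2) * ∑ j ∈ Finset.Icc 1 N, fLB j β1 β2 ≤ ∑ i ∈ S, w i * fLB i β1 β2 ∧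
      ∑ i ∈ S, w i * fLB i β1 β2 ≤ (3 / 2) * ∑ j ∈ Finset.Icc 1 N, fLB j β1 β2) :
    ∀ i ∈ S, w i < 2 := by
  intro i hi
  have hupper := (hcore ![((4 : ℝ) ^ i)⁻¹, 0] ![0, (4 : ℝ) ^ i]).2
  have hsingle := Finset.single_le_sum
    (f := fun j => w j * fLB j ![((4 : ℝ) ^ i)⁻¹, 0] ![0, (4 : ℝ) ^ i])
    (fun j hj => mul_nonneg (hw j hj) (fLB_nonneg j _ _)) hi
  simp only [fLB_peak] at hupper hsingle
  simp only [Nat.sub_self, add_zero, pow_zero, mul_one] at hsingle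
  linarith [sum_two_sided_geom_le i N]
end

section
/- For any matrix A ∈ ℝ^{n×d} with rows a_1,…,a_n and any vector b ∈ ℝ^n, there exist a subset S ⊆ [n] with |S| ≤ (d+1)²+1 and weights w : S → ℝ_{≥0} such that for every β ∈ ℝ^d, Σ_{i∈S} w(i)·(⟨a_i,β⟩ − b_i)² = Σ_{i=1}^n (⟨a_i,β⟩ − b_i)². -/
/-- **Carathéodory's theorem for cones**: a conic combination of a finite family in a
finite-dimensional space is a conic combination of at most `finrank` of its members. -/
theorem exists_conic_combination_card_le_finrank {𝕜 ι M : Type*} [Field 𝕜] [LinearOrder 𝕜]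
    [IsStrictOrderedRing 𝕜] [AddCommGroup M] [Module 𝕜 M] [FiniteDimensional 𝕜 M]
    (v : ι → M) (S : Finset ι) (w : ι → 𝕜) (hw : ∀ i ∈ S, 0 ≤ w i) :
    ∃ T ⊆ S, ∃ w' : ι → 𝕜, T.card ≤ Module.finrank 𝕜 M ∧ (∀ i ∈ T, 0 ≤ w' i) ∧
      ∑ i ∈ T, w' i • v i = ∑ i ∈ S, w i • v i := by
  classical
  induction S using Finset.strongInduction generalizing w with
  | H S ih =>
  by_cases hS : S.card ≤ Module.finrank 𝕜 M
  · exact ⟨S, subset_rfl, w, hS, hw, rfl⟩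
  have hdep : ¬ LinearIndepOn 𝕜 v (S : Set ι) := fun h => hS <| by
    simpa using LinearIndependent.fintype_card_le_finrank h
  obtain ⟨g, hg, i₁, hi₁, hpos⟩ :
      ∃ g : ι → 𝕜, ∑ i ∈ S, g i • v i = 0 ∧ ∃ i ∈ S, 0 < g i := by
    rw [linearIndepOn_finset_iff] at hdep
    push Not at hdep
    obtain ⟨g, hg, i, hi, hne⟩ := hdep
    rcases hne.lt_or_gt with h | h
    · exact ⟨-g, by simp [hg], i, hi, by simpa using h⟩
    · exact ⟨g, hg, i, hi, h⟩
  obtain ⟨i₀, hi₀, hmin⟩ := Finset.exists_min_image (S.filter fun i => 0 < g i)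
    (fun i => w i / g i) ⟨i₁, by simp [hi₁, hpos]⟩
  simp only [Finset.mem_filter, and_imp] at hi₀ hmin
  obtain ⟨hi₀S, hg₀⟩ := hi₀
  set c := w i₀ / g i₀
  have hc : 0 ≤ c := div_nonneg (hw i₀ hi₀S) hg₀.le
  have hw' : ∀ i ∈ S, 0 ≤ w i - c * g i := by
    intro i hi
    rcases lt_or_ge 0 (g i) with h | h
    · exact sub_nonneg.2 ((le_div_iff₀ h).1 (hmin i hi h))
    · linarith [hw i hi, mul_nonpos_of_nonneg_of_nonpos hc h]
  have hzero : w i₀ - c * g i₀ = 0 := by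
    rw [div_mul_cancel₀ _ hg₀.ne', sub_self]
  obtain ⟨T, hT, w', hcard, hnonneg, hsum⟩ := ih (S.erase i₀) (Finset.erase_ssubset hi₀S)
    (fun i => w i - c * g i) fun i hi => hw' i (Finset.mem_of_mem_erase hi)
  refine ⟨T, hT.trans (Finset.erase_subset _ _), w', hcard, hnonneg, hsum.trans ?_⟩
  rw [Finset.sum_erase _ (by rw [hzero, zero_smul])]
  simp only [sub_smul, mul_smul, Finset.sum_sub_distrib, ← Finset.smul_sum, hg, smul_zero,
    sub_zero]

/-- accurate (zero-error) coresets for least-squares regression: a weighted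
subset of at most `(d+1)² + 1` rows whose weighted least-squares objective agrees with the
full objective at every `β`. -/
theorem accurate_coreset_least_squares
    (n d : ℕ) (A : Matrix (Fin n) (Fin d) ℝ) (b : Fin n → ℝ) :
    ∃ (S : Finset (Fin n)) (w : Fin n → ℝ),
      S.card ≤ (d + 1) ^ 2 + 1 ∧
      (∀ i ∈ S, 0 ≤ w i) ∧
      ∀ β : Fin d → ℝ,
        ∑ i ∈ S, w i * (∑ j, A i j * β j - b i) ^ 2 =
          ∑ i, (∑ j, A i j * β j - b i) ^ 2 := by
  let u : Fin n → Fin (d + 1) → ℝ := fun i => Fin.cons (-b i) (A i)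
  obtain ⟨S, -, w, hcard, hw, hsum⟩ := exists_conic_combination_card_le_finrank (𝕜 := ℝ)
    (fun i => Matrix.vecMulVec (u i) (u i)) Finset.univ (fun _ => 1) fun _ _ => zero_le_one
  refine ⟨S, w, ?_, hw, fun β => ?_⟩
  · rw [Module.finrank_matrix] at hcard
    simp only [Fintype.card_fin, Module.finrank_self, mul_one] at hcard
    nlinarith
  · let x : Fin (d + 1) → ℝ := Fin.cons 1 β
    let q : Matrix (Fin (d + 1)) (Fin (d + 1)) ℝ →ₗ[ℝ] ℝ :=
      { toFun := fun M => x ⬝ᵥ M.mulVec x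
        map_add' := fun M N => by rw [Matrix.add_mulVec, dotProduct_add]
        map_smul' := fun c M => by rw [Matrix.smul_mulVec, dotProduct_smul, RingHom.id_apply] }
    have hq : ∀ i, q (Matrix.vecMulVec (u i) (u i)) = (∑ j, A i j * β j - b i) ^ 2 := by
      intro i
      have hux : u i ⬝ᵥ x = ∑ j, A i j * β j - b i := by
        simp [u, x, dotProduct, Fin.sum_univ_succ]
        ring
      change x ⬝ᵥ (Matrix.vecMulVec (u i) (u i)).mulVec x = _
      rw [Matrix.vecMulVec_mulVec, dotProduct_smul, dotProduct_comm x, hux]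
      simp [sq]
    simpa [hq] using congrArg q hsum
end

section
/- There exists an absolute constant C > 0 such that for every panel dataset (x_{it} ∈ ℝ^d, y_{it} ∈ ℝ for i ∈ [N], t ∈ [T]) and every ε ∈ (0,1), there exist a subset S ⊆ [N]×[T] with |S| ≤ C·d/ε² and weights w : S → ℝ_{≥0} such that for every β ∈ ℝ^d, (1−ε)·ψ^O(β) ≤ Σ_{(i,t)∈S} w(i,t)·ψ^O_{it}(β) ≤ (1+ε)·ψ^O(β). -/
open Matrix

section PosDef

variable {ι : Type*} [Fintype ι]

lemma Matrix.IsHermitian.vecMul_eq_mulVec {A : Matrix ι ι ℝ} (hA : A.IsHermitian) (v : ι → ℝ) :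
    v ᵥ* A = A *ᵥ v := by
  have h : Aᵀ = A := by rw [← conjTranspose_eq_transpose_of_trivial, hA.eq]
  rw [← mulVec_transpose, h]

lemma dotProduct_sum_smul_vecMulVec_mulVec {κ : Type*} [Fintype κ] (w : κ → ℝ) (v : κ → ι → ℝ)
    (c : ι → ℝ) :
    c ⬝ᵥ (∑ k, w k • vecMulVec (v k) (v k)) *ᵥ c = ∑ k, w k * (v k ⬝ᵥ c) ^ 2 := by
  simp only [sum_mulVec, dotProduct_sum, smul_mulVec, vecMulVec_mulVec, dotProduct_smul,
    op_smul_eq_smul, smul_eq_mul, dotProduct_comm c (v _), sq]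

variable [DecidableEq ι]

open scoped MatrixOrder in
lemma Matrix.PosSemidef.exists_eq_transpose_mul_self {A : Matrix ι ι ℝ} (hA : A.PosSemidef) :
    ∃ B : Matrix ι ι ℝ, A = Bᵀ * B := by
  obtain ⟨B, hB⟩ := CStarAlgebra.nonneg_iff_eq_star_mul_self.mp hA.nonneg
  exact ⟨B, by simpa [star_eq_conjTranspose] using hB⟩

lemma Matrix.PosSemidef.trace_mul_nonneg {A B : Matrix ι ι ℝ} (hA : A.PosSemidef)
    (hB : B.PosSemidef) : 0 ≤ (A * B).trace := by
  obtain ⟨C, rfl⟩ := hA.exists_eq_transpose_mul_self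
  rw [Matrix.mul_assoc, Matrix.trace_mul_comm]
  simpa using (hB.mul_mul_conjTranspose_same C).trace_nonneg

lemma Matrix.PosSemidef.trace_smul_one_sub {A : Matrix ι ι ℝ} (hA : A.PosSemidef) :
    (A.trace • (1 : Matrix ι ι ℝ) - A).PosSemidef := by
  obtain ⟨C, rfl⟩ := hA.exists_eq_transpose_mul_self
  refine .of_dotProduct_mulVec_nonneg (by simp [IsHermitian, transpose_sub]) fun x => ?_
  have h1 : x ⬝ᵥ ((Cᵀ * C) *ᵥ x) = ∑ i, (C i ⬝ᵥ x) ^ 2 := by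
    rw [← mulVec_mulVec, dotProduct_mulVec, vecMul_transpose]
    simp [dotProduct, mulVec, sq]
  have h2 : (Cᵀ * C).trace = ∑ i, C i ⬝ᵥ C i := by
    rw [trace_mul_comm]
    simp [trace, mul_apply, dotProduct]
  simp only [star_trivial, sub_mulVec, dotProduct_sub, smul_mulVec, one_mulVec, dotProduct_smul,
    h1, h2, smul_eq_mul, Finset.sum_mul, sub_nonneg]
  gcongr with i
  simpa [dotProduct, sq] using Finset.sum_mul_sq_le_sq_mul_sq Finset.univ (C i) x

lemma Matrix.PosDef.mul_self {A : Matrix ι ι ℝ} (hA : A.PosDef) : (A * A).PosDef := by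
  have := PosDef.conjTranspose_mul_mul_same (B := A) PosDef.one
    (mulVec_injective_of_isUnit hA.isUnit)
  rwa [hA.isHermitian.eq, mul_one] at this

lemma Matrix.PosDef.inv_add_smul_vecMulVec {M : Matrix ι ι ℝ} (hM : M.PosDef) (v : ι → ℝ) {c : ℝ}
    (hc : 1 + c * (v ⬝ᵥ M⁻¹ *ᵥ v) ≠ 0) :
    (M + c • vecMulVec v v)⁻¹ =
      M⁻¹ - (c / (1 + c * (v ⬝ᵥ M⁻¹ *ᵥ v))) • vecMulVec (M⁻¹ *ᵥ v) (M⁻¹ *ᵥ v) := by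
  have hu : IsUnit M.det := (isUnit_iff_isUnit_det M).mp hM.isUnit
  have hsymm := hM.inv.isHermitian.vecMul_eq_mulVec v
  apply inv_eq_right_inv
  simp only [add_mul, mul_sub, mul_nonsing_inv _ hu, Matrix.mul_smul, Matrix.smul_mul,
    mul_vecMulVec, vecMulVec_mul, hsymm, mulVec_mulVec, one_mulVec, smul_mulVec, vecMulVec_mulVec]
  ext i j
  simp [vecMulVec_apply, dotProduct_comm _ v]
  field_simp
  ring

lemma Matrix.PosDef.trace_inv_add_smul_vecMulVec {M : Matrix ι ι ℝ} (hM : M.PosDef) (v : ι → ℝ)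
    {c : ℝ} (hc : 1 + c * (v ⬝ᵥ M⁻¹ *ᵥ v) ≠ 0) :
    (M + c • vecMulVec v v)⁻¹.trace =
      M⁻¹.trace - c / (1 + c * (v ⬝ᵥ M⁻¹ *ᵥ v)) * (v ⬝ᵥ (M⁻¹ * M⁻¹) *ᵥ v) := by
  have hsymm := hM.inv.isHermitian.vecMul_eq_mulVec v
  rw [hM.inv_add_smul_vecMulVec v hc, trace_sub, trace_smul, trace_vecMulVec, ← mulVec_mulVec,
    dotProduct_mulVec v M⁻¹ (M⁻¹ *ᵥ v), hsymm, smul_eq_mul]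

/-- The upper barrier potential does not increase under a small enough rank-one update. -/
lemma posDef_sub_and_trace_inv_le {M : Matrix ι ι ℝ} (hM : M.PosDef) {v : ι → ℝ}
    (hv : v ≠ 0) {t φ : ℝ} (ht : 0 < t) (hφ : M⁻¹.trace < φ)
    (h : (v ⬝ᵥ (M⁻¹ * M⁻¹) *ᵥ v) / (φ - M⁻¹.trace) + v ⬝ᵥ M⁻¹ *ᵥ v ≤ 1 / t) :
    (M - t • vecMulVec v v).PosDef ∧ (M - t • vecMulVec v v)⁻¹.trace ≤ φ := by
  have hD : 0 < φ - M⁻¹.trace := sub_pos.mpr hφ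
  have hb : 0 < v ⬝ᵥ (M⁻¹ * M⁻¹) *ᵥ v := by
    simpa using hM.inv.mul_self.dotProduct_mulVec_pos hv
  set a := v ⬝ᵥ M⁻¹ *ᵥ v
  set b := v ⬝ᵥ (M⁻¹ * M⁻¹) *ᵥ v
  have hbD : b / (φ - M⁻¹.trace) ≤ 1 / t - a := by linarith
  have hat : 0 < 1 / t - a := lt_of_lt_of_le (by positivity) hbD
  have hta : 0 < 1 - t * a := by
    have : t * (1 / t - a) = 1 - t * a := by field_simp
    rw [← this]; positivity
  have hc : 1 + -t * a ≠ 0 := by linarith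
  have hinv := hM.inv_add_smul_vecMulVec v hc
  have htr := hM.trace_inv_add_smul_vecMulVec v hc
  rw [neg_smul, ← sub_eq_add_neg] at hinv htr
  constructor
  · rw [← posDef_inv_iff, hinv, sub_eq_add_neg, ← neg_smul]
    refine hM.inv.add_posSemidef (PosSemidef.smul ?_ ?_)
    · simpa using posSemidef_vecMulVec_self_star (M⁻¹ *ᵥ v)
    · rw [← neg_div, neg_neg, show 1 + -t * a = 1 - t * a by ring]
      positivity
  · rw [htr]
    have : t * b ≤ (φ - M⁻¹.trace) * (1 - t * a) := by
      rw [div_le_iff₀ hD] at hbD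
      calc t * b ≤ t * ((1 / t - a) * (φ - M⁻¹.trace)) := by gcongr
        _ = _ := by field_simp
    have h3 : -t / (1 + -t * a) * b = - (t * b / (1 - t * a)) := by
      rw [show 1 + -t * a = 1 - t * a by ring]; ring
    have := (div_le_iff₀ hta).mpr this
    rw [h3]
    linarith

/-- The lower barrier potential does not increase under a large enough rank-one update. -/
lemma posDef_add_and_trace_inv_le {M : Matrix ι ι ℝ} (hM : M.PosDef) {v : ι → ℝ}
    {t φ : ℝ} (ht : 0 < t) (hφ : φ < M⁻¹.trace)
    (h : 1 / t ≤ (v ⬝ᵥ (M⁻¹ * M⁻¹) *ᵥ v) / (M⁻¹.trace - φ) - v ⬝ᵥ M⁻¹ *ᵥ v) :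
    (M + t • vecMulVec v v).PosDef ∧ (M + t • vecMulVec v v)⁻¹.trace ≤ φ := by
  have hD : 0 < M⁻¹.trace - φ := sub_pos.mpr hφ
  have ha : 0 ≤ v ⬝ᵥ M⁻¹ *ᵥ v := by
    simpa using hM.inv.posSemidef.dotProduct_mulVec_nonneg v
  have hc : 0 < 1 + t * (v ⬝ᵥ M⁻¹ *ᵥ v) := by positivity
  constructor
  · refine hM.add_posSemidef (PosSemidef.smul ?_ ht.le)
    simpa using posSemidef_vecMulVec_self_star v
  · rw [hM.trace_inv_add_smul_vecMulVec v hc.ne']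
    set a := v ⬝ᵥ M⁻¹ *ᵥ v
    set b := v ⬝ᵥ (M⁻¹ * M⁻¹) *ᵥ v
    have : (M⁻¹.trace - φ) * (1 + t * a) ≤ t * b := by
      have h' : 1 / t + a ≤ b / (M⁻¹.trace - φ) := by linarith
      rw [le_div_iff₀ hD] at h'
      calc _ = t * ((1 / t + a) * (M⁻¹.trace - φ)) := by field_simp
        _ ≤ _ := by gcongr
    have := (le_div_iff₀ hc).mpr this
    rw [div_mul_eq_mul_div]
    linarith

lemma trace_inv_add_smul_one_bounds [Nonempty ι] {N : Matrix ι ι ℝ} (hN : N.PosDef) {δ : ℝ}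
    (hδ : 0 < δ) :
    (N + δ • 1)⁻¹.trace < N⁻¹.trace ∧
      δ * ((N + δ • 1)⁻¹ * (N + δ • 1)⁻¹).trace ≤ N⁻¹.trace - (N + δ • 1)⁻¹.trace := by
  have hM : (N + δ • 1).PosDef := hN.add (PosDef.one.smul hδ)
  set M := N + δ • 1 with hMdef
  have hNu : IsUnit N.det := (isUnit_iff_isUnit_det N).mp hN.isUnit
  have hMu : IsUnit M.det := (isUnit_iff_isUnit_det M).mp hM.isUnit
  have hres : N⁻¹ = M⁻¹ + δ • (M⁻¹ * N⁻¹) := by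
    calc N⁻¹ = M⁻¹ * M * N⁻¹ := by rw [nonsing_inv_mul _ hMu, one_mul]
      _ = M⁻¹ * (N + δ • 1) * N⁻¹ := by rw [← hMdef]
      _ = _ := by simp [mul_add, add_mul, mul_assoc, mul_nonsing_inv _ hNu]
  have hres' : N⁻¹ = M⁻¹ + δ • (N⁻¹ * M⁻¹) := by
    calc N⁻¹ = N⁻¹ * (M * M⁻¹) := by rw [mul_nonsing_inv _ hMu, mul_one]
      _ = N⁻¹ * ((N + δ • 1) * M⁻¹) := by rw [← hMdef]
      _ = _ := by simp [mul_add, add_mul, ← mul_assoc, nonsing_inv_mul _ hNu]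
  have hexp : N⁻¹ = M⁻¹ + δ • (M⁻¹ * M⁻¹) + (δ * δ) • (M⁻¹ * N⁻¹ * M⁻¹) := by
    conv_lhs => rw [hres, hres']
    simp [mul_add, smul_smul, mul_assoc, add_assoc]
  have htr := congrArg trace hexp
  simp only [trace_add, trace_smul, smul_eq_mul] at htr
  have h1 : 0 ≤ (M⁻¹ * N⁻¹ * M⁻¹).trace := by
    have := hN.inv.posSemidef.conjTranspose_mul_mul_same M⁻¹
    rw [hM.inv.isHermitian.eq] at this
    exact this.trace_nonneg
  have h2 : 0 < (M⁻¹ * M⁻¹).trace := hM.inv.mul_self.trace_pos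
  have h3 : 0 ≤ δ * δ * (M⁻¹ * N⁻¹ * M⁻¹).trace := by positivity
  have h4 : 0 < δ * (M⁻¹ * M⁻¹).trace := by positivity
  constructor <;> linarith

lemma posDef_sub_smul_one [Nonempty ι] {N : Matrix ι ι ℝ} (hN : N.PosDef) {δ : ℝ}
    (hδ : δ * N⁻¹.trace < 1) : (N - δ • 1).PosDef := by
  have hNu : IsUnit N.det := (isUnit_iff_isUnit_det N).mp hN.isUnit
  set φ := N⁻¹.trace with hφdef
  have hφ : 0 < φ := hN.inv.trace_pos
  have h1 : ((1 - φ • N) * N⁻¹ * (1 - φ • N)).PosSemidef := by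
    have := hN.inv.posSemidef.conjTranspose_mul_mul_same (1 - φ • N)
    rwa [show (1 - φ • N)ᴴ = 1 - φ • N by
      have := hN.isHermitian.eq
      simp_all] at this
  have h2 := h1.add hN.inv.posSemidef.trace_smul_one_sub
  have h3 : N - δ • (1 : Matrix ι ι ℝ) = (1 / φ - δ) • (1 : Matrix ι ι ℝ) + (1 / φ ^ 2) •
      ((1 - φ • N) * N⁻¹ * (1 - φ • N) + (N⁻¹.trace • (1 : Matrix ι ι ℝ) - N⁻¹)) := by
    rw [← hφdef]
    simp only [sub_mul, mul_sub, one_mul, mul_one, Matrix.smul_mul, Matrix.mul_smul,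
      mul_nonsing_inv _ hNu, nonsing_inv_mul _ hNu]
    ext i j
    simp
    field_simp
    ring
  rw [h3]
  refine (PosDef.one.smul ?_).add_posSemidef (h2.smul (by positivity))
  rw [sub_pos, lt_div_iff₀ hφ]
  exact hδ

lemma trace_inv_sub_smul_one_bounds [Nonempty ι] {N : Matrix ι ι ℝ} (hN : N.PosDef) {δ : ℝ}
    (hδ : 0 < δ) (hδN : δ * N⁻¹.trace < 1) :
    N⁻¹.trace < (N - δ • 1)⁻¹.trace ∧
      (N - δ • 1)⁻¹.trace - N⁻¹.trace ≤ δ * ((N - δ • 1)⁻¹ * (N - δ • 1)⁻¹).trace ∧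
      (N - δ • 1)⁻¹.trace * (1 - δ * N⁻¹.trace) ≤ N⁻¹.trace := by
  have hM : (N - δ • 1).PosDef := posDef_sub_smul_one hN hδN
  set M := N - δ • 1 with hMdef
  have hNM : N = M + δ • 1 := by simp [hMdef]
  have hNu : IsUnit N.det := (isUnit_iff_isUnit_det N).mp hN.isUnit
  have hMu : IsUnit M.det := (isUnit_iff_isUnit_det M).mp hM.isUnit
  have hup := trace_inv_add_smul_one_bounds hM hδ
  rw [← hNM] at hup
  have hres : M⁻¹ = N⁻¹ + δ • (M⁻¹ * N⁻¹) := by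
    calc M⁻¹ = M⁻¹ * (N * N⁻¹) := by rw [mul_nonsing_inv _ hNu, mul_one]
      _ = M⁻¹ * ((M + δ • 1) * N⁻¹) := by rw [← hNM]
      _ = _ := by simp [mul_add, add_mul, ← mul_assoc, nonsing_inv_mul _ hMu]
  have hres' : M⁻¹ = N⁻¹ + δ • (N⁻¹ * M⁻¹) := by
    calc M⁻¹ = N⁻¹ * N * M⁻¹ := by rw [nonsing_inv_mul _ hNu, one_mul]
      _ = N⁻¹ * (M + δ • 1) * M⁻¹ := by rw [← hNM]
      _ = _ := by simp [mul_add, add_mul, mul_assoc, mul_nonsing_inv _ hMu]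
  have htr := congrArg trace hres
  simp only [trace_add, trace_smul, smul_eq_mul] at htr
  have h1 : (M⁻¹ * N⁻¹).trace ≤ (M⁻¹ * M⁻¹).trace := by
    have hexp : M⁻¹ * M⁻¹ = M⁻¹ * N⁻¹ + δ • (M⁻¹ * N⁻¹ * M⁻¹) := by
      conv_lhs => rw [← congrArg (M⁻¹ * ·) hres'.symm]
      simp [mul_add, mul_assoc]
    have h := hN.inv.posSemidef.conjTranspose_mul_mul_same M⁻¹
    rw [hM.inv.isHermitian.eq] at h
    have htr' := congrArg trace hexp
    simp only [trace_add, trace_smul, smul_eq_mul] at htr'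
    nlinarith [h.trace_nonneg]
  have h2 : (M⁻¹ * N⁻¹).trace ≤ M⁻¹.trace * N⁻¹.trace := by
    have := hM.inv.posSemidef.trace_mul_nonneg hN.inv.posSemidef.trace_smul_one_sub
    simp only [mul_sub, trace_sub, Matrix.mul_smul, mul_one, trace_smul, smul_eq_mul] at this
    linarith
  refine ⟨hup.1, by nlinarith, by nlinarith⟩

lemma sum_dotProduct_mulVec_eq_trace {κ : Type*} [Fintype κ] {v : κ → ι → ℝ}
    (hv : ∑ k, vecMulVec (v k) (v k) = 1) (B : Matrix ι ι ℝ) :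
    ∑ k, v k ⬝ᵥ B *ᵥ v k = B.trace := by
  calc ∑ k, v k ⬝ᵥ B *ᵥ v k = ∑ k, (B * vecMulVec (v k) (v k)).trace := by
        simp [mul_vecMulVec, trace_vecMulVec, dotProduct_comm]
    _ = B.trace := by rw [← trace_sum, ← Finset.mul_sum, hv, mul_one]

/-- Some rank-one update lets both barriers advance without increasing either potential. -/
lemma barrier_step [Nonempty ι] {κ : Type*} [Fintype κ] {v : κ → ι → ℝ}
    (hv : ∑ k, vecMulVec (v k) (v k) = 1) {ε : ℝ} (hε : 0 < ε) (hε1 : ε < 1)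
    {A : Matrix ι ι ℝ} {u l : ℝ}
    (hu : (u • 1 - A).PosDef) (hut : (u • 1 - A)⁻¹.trace ≤ ε / 8)
    (hl : (A - l • 1).PosDef) (hlt : (A - l • 1)⁻¹.trace ≤ ε / 8) :
    ∃ k, ∃ t : ℝ, 0 < t ∧
      ((u + (1 + ε / 2)) • 1 - (A + t • vecMulVec (v k) (v k))).PosDef ∧
      ((u + (1 + ε / 2)) • 1 - (A + t • vecMulVec (v k) (v k)))⁻¹.trace ≤ ε / 8 ∧
      (A + t • vecMulVec (v k) (v k) - (l + 1) • 1).PosDef ∧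
      (A + t • vecMulVec (v k) (v k) - (l + 1) • 1)⁻¹.trace ≤ ε / 8 := by
  have hη : 0 < 1 + ε / 2 := by positivity
  obtain ⟨hU1, hU2⟩ := trace_inv_add_smul_one_bounds hu hη
  obtain ⟨hL1, hL2, hL3⟩ := trace_inv_sub_smul_one_bounds hl one_pos (by linarith)
  have hMu : (u • 1 - A + (1 + ε / 2) • 1).PosDef := hu.add (PosDef.one.smul hη)
  have hMl : (A - l • 1 - (1 : ℝ) • 1).PosDef := posDef_sub_smul_one hl (by linarith)
  have eu (B : Matrix ι ι ℝ) :
      (u + (1 + ε / 2)) • 1 - (A + B) = u • 1 - A + (1 + ε / 2) • 1 - B := by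
    rw [add_smul]; abel
  have el (B : Matrix ι ι ℝ) :
      A + B - (l + 1) • 1 = A - l • 1 - (1 : ℝ) • 1 + B := by
    rw [add_smul]; abel
  simp only [eu, el]
  have hΦ := hl.inv.trace_pos
  set Mu := u • 1 - A + (1 + ε / 2) • 1
  set Ml := A - l • 1 - (1 : ℝ) • 1
  set φu := (u • 1 - A)⁻¹.trace
  set φl := (A - l • 1)⁻¹.trace
  have hDu : 0 < φu - Mu⁻¹.trace := sub_pos.mpr hU1
  have hDl : 0 < Ml⁻¹.trace - φl := sub_pos.mpr hL1
  have hsum : ∑ k, ((v k ⬝ᵥ (Mu⁻¹ * Mu⁻¹) *ᵥ v k) / (φu - Mu⁻¹.trace) + v k ⬝ᵥ Mu⁻¹ *ᵥ v k) <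
      ∑ k, ((v k ⬝ᵥ (Ml⁻¹ * Ml⁻¹) *ᵥ v k) / (Ml⁻¹.trace - φl) - v k ⬝ᵥ Ml⁻¹ *ᵥ v k) := by
    rw [Finset.sum_add_distrib, Finset.sum_sub_distrib, ← Finset.sum_div, ← Finset.sum_div]
    simp only [sum_dotProduct_mulVec_eq_trace hv]
    have h1 : (Mu⁻¹ * Mu⁻¹).trace / (φu - Mu⁻¹.trace) ≤ 1 - ε / 3 := by
      rw [div_le_iff₀ hDu]
      have : (Mu⁻¹ * Mu⁻¹).trace ≤ (φu - Mu⁻¹.trace) / (1 + ε / 2) := by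
        rw [le_div_iff₀ hη]; linarith
      refine this.trans ?_
      rw [div_le_iff₀ hη]
      nlinarith [mul_nonneg hDu.le (mul_nonneg hε.le (sub_nonneg.mpr hε1.le))]
    have h2 : 1 ≤ (Ml⁻¹ * Ml⁻¹).trace / (Ml⁻¹.trace - φl) := by
      rw [le_div_iff₀ hDl]; linarith
    have h3 : Ml⁻¹.trace ≤ ε / 7 := by
      have : 7 / 8 ≤ 1 - 1 * φl := by linarith
      nlinarith [hMl.inv.trace_pos]
    linarith
  obtain ⟨k, -, hk⟩ := Finset.exists_lt_of_sum_lt hsum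
  have hU0 : 0 ≤ (v k ⬝ᵥ (Mu⁻¹ * Mu⁻¹) *ᵥ v k) / (φu - Mu⁻¹.trace) + v k ⬝ᵥ Mu⁻¹ *ᵥ v k := by
    have h1 := hMu.inv.mul_self.posSemidef.dotProduct_mulVec_nonneg (v k)
    have h2 := hMu.inv.posSemidef.dotProduct_mulVec_nonneg (v k)
    simp only [star_trivial] at h1 h2
    positivity
  have hvk : v k ≠ 0 := by
    intro h
    simp [h] at hk
  set L := (v k ⬝ᵥ (Ml⁻¹ * Ml⁻¹) *ᵥ v k) / (Ml⁻¹.trace - φl) - v k ⬝ᵥ Ml⁻¹ *ᵥ v k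
  have hL : 0 < L := hU0.trans_lt hk
  obtain ⟨h1, h2⟩ := posDef_sub_and_trace_inv_le hMu hvk (inv_pos.mpr hL) hU1
    (by rw [one_div, inv_inv]; exact hk.le)
  obtain ⟨h3, h4⟩ := posDef_add_and_trace_inv_le hMl (v := v k) (inv_pos.mpr hL) hL1
    (by rw [one_div, inv_inv])
  exact ⟨k, L⁻¹, inv_pos.mpr hL, h1, h2.trans hut, h3, h4.trans hlt⟩

lemma exists_weights_barrier [Nonempty ι] {κ : Type*} [Fintype κ] {v : κ → ι → ℝ}
    (hv : ∑ k, vecMulVec (v k) (v k) = 1) {ε : ℝ} (hε : 0 < ε) (hε1 : ε < 1) (q : ℕ) :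
    ∃ w : κ → ℝ, (∀ k, 0 ≤ w k) ∧ (Finset.univ.filter fun k => w k ≠ 0).card ≤ q ∧
      ((8 * Fintype.card ι / ε + q * (1 + ε / 2)) • 1 -
        ∑ k, w k • vecMulVec (v k) (v k)).PosDef ∧
      ((8 * Fintype.card ι / ε + q * (1 + ε / 2)) • 1 -
        ∑ k, w k • vecMulVec (v k) (v k))⁻¹.trace ≤ ε / 8 ∧
      (∑ k, w k • vecMulVec (v k) (v k) - (-(8 * Fintype.card ι / ε) + q) • 1).PosDef ∧
      (∑ k, w k • vecMulVec (v k) (v k) -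
        (-(8 * Fintype.card ι / ε) + q) • 1)⁻¹.trace ≤ ε / 8 := by
  classical
  induction q with
  | zero =>
    have hr : (0 : ℝ) < Fintype.card ι := by exact_mod_cast Fintype.card_pos
    have hc : 0 < 8 * (Fintype.card ι : ℝ) / ε := by positivity
    have hpd : ((8 * (Fintype.card ι : ℝ) / ε) • (1 : Matrix ι ι ℝ)).PosDef := PosDef.one.smul hc
    have htr : ((8 * (Fintype.card ι : ℝ) / ε) • (1 : Matrix ι ι ℝ))⁻¹.trace ≤ ε / 8 := by
      have : ((8 * (Fintype.card ι : ℝ) / ε) • (1 : Matrix ι ι ℝ))⁻¹ =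
          (8 * (Fintype.card ι : ℝ) / ε)⁻¹ • 1 := by
        apply inv_eq_right_inv
        rw [smul_mul_smul_comm, mul_inv_cancel₀ hc.ne', one_mul, one_smul]
      rw [this, trace_smul, trace_one, smul_eq_mul]
      apply le_of_eq
      field_simp
    refine ⟨0, by simp, by simp, ?_⟩
    simpa using And.intro hpd ⟨htr, hpd, htr⟩
  | succ q ih =>
    obtain ⟨w, hw, hcard, h1, h2, h3, h4⟩ := ih
    obtain ⟨k, t, ht, h⟩ := barrier_step hv hε hε1 h1 h2 h3 h4
    have hsum : ∑ j, (w + Pi.single k t : κ → ℝ) j • vecMulVec (v j) (v j) =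
        ∑ j, w j • vecMulVec (v j) (v j) + t • vecMulVec (v k) (v k) := by
      simp [add_smul, Finset.sum_add_distrib, Pi.single_apply, ite_smul]
    refine ⟨w + Pi.single k t, fun j => ?_, ?_, ?_⟩
    · exact add_nonneg (hw j) ((Pi.single_nonneg.mpr ht.le : (0 : κ → ℝ) ≤ Pi.single k t) j)
    · refine le_trans (Finset.card_le_card (t := insert k (Finset.univ.filter fun j => w j ≠ 0))
        fun j hj => ?_) ((Finset.card_insert_le _ _).trans (by omega))
      by_cases hjk : j = k
      · simp [hjk]
      · simpa [hjk] using hj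
    · rw [hsum]
      push_cast
      rwa [add_one_mul (q : ℝ), ← add_assoc, ← add_assoc _ (q : ℝ)]

/-- Spectral sparsification of a decomposition of the identity, after Batson, Spielman and
Srivastava. -/
theorem exists_sparse_weights_of_isotropic {κ : Type*} [Fintype κ] {v : κ → ι → ℝ}
    (hv : ∑ k, vecMulVec (v k) (v k) = 1) {ε : ℝ} (hε : 0 < ε) (hε1 : ε < 1) :
    ∃ w : κ → ℝ, (∀ k, 0 ≤ w k) ∧
      ((Finset.univ.filter fun k => w k ≠ 0).card : ℝ) ≤ 17 * Fintype.card ι / ε ^ 2 ∧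
      ∀ c : ι → ℝ, (1 - ε) * (c ⬝ᵥ c) ≤ ∑ k, w k * (v k ⬝ᵥ c) ^ 2 ∧
        ∑ k, w k * (v k ⬝ᵥ c) ^ 2 ≤ (1 + ε) * (c ⬝ᵥ c) := by
  rcases isEmpty_or_nonempty ι with hι | hι
  · exact ⟨0, by simp, by simp, by simp [dotProduct]⟩
  have hr : (1 : ℝ) ≤ Fintype.card ι := by exact_mod_cast Fintype.card_pos
  set r : ℝ := (Fintype.card ι : ℝ)
  obtain ⟨q, hq, hq'⟩ : ∃ q : ℕ, 16 * r / ε ^ 2 ≤ q ∧ (q : ℝ) ≤ 17 * r / ε ^ 2 := by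
    refine ⟨⌈16 * r / ε ^ 2⌉₊, Nat.le_ceil _, (Nat.ceil_lt_add_one (by positivity)).le.trans ?_⟩
    rw [← sub_nonneg]
    have : 17 * r / ε ^ 2 - (16 * r / ε ^ 2 + 1) = (r - ε ^ 2) / ε ^ 2 := by field_simp; ring
    rw [this]
    have : 0 ≤ r - ε ^ 2 := by nlinarith
    positivity
  obtain ⟨w, hw, hcard, hu, -, hl, -⟩ := exists_weights_barrier hv hε hε1 q
  have hq0 : (0 : ℝ) < q := lt_of_lt_of_le (by positivity) hq
  have hrq : 8 * r / ε ≤ q * (ε / 2) := by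
    have : 8 * r / ε = 16 * r / ε ^ 2 * (ε / 2) := by field_simp; norm_num
    rw [this]; gcongr
  refine ⟨fun k => w k / q, fun k => div_nonneg (hw k) hq0.le, ?_, fun c => ?_⟩
  · refine le_trans ?_ hq'
    exact_mod_cast le_trans (le_of_eq (by simp [hq0.ne'])) hcard
  · have h1 := hu.posSemidef.dotProduct_mulVec_nonneg c
    have h2 := hl.posSemidef.dotProduct_mulVec_nonneg c
    simp only [star_trivial, sub_mulVec, dotProduct_sub, smul_mulVec, one_mulVec, dotProduct_smul,
      smul_eq_mul, dotProduct_sum_smul_vecMulVec_mulVec] at h1 h2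
    have hcc : 0 ≤ c ⬝ᵥ c := by simpa using dotProduct_star_self_nonneg c
    have hs : ∑ k, w k / q * (v k ⬝ᵥ c) ^ 2 = (∑ k, w k * (v k ⬝ᵥ c) ^ 2) / q := by
      rw [Finset.sum_div]
      exact Finset.sum_congr rfl fun k _ => by ring
    rw [hs, le_div_iff₀ hq0, div_le_iff₀ hq0]
    have h3 := mul_le_mul_of_nonneg_right hrq hcc
    have h4 : 0 ≤ q * ε * (c ⬝ᵥ c) := by positivity
    constructor <;> nlinarith

end PosDef

theorem Submodule.exists_sparse_weights {κ : Type*} [Fintype κ]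
    (U : Submodule ℝ (EuclideanSpace ℝ κ)) {ε : ℝ} (hε : 0 < ε) (hε1 : ε < 1) :
    ∃ w : κ → ℝ, (∀ k, 0 ≤ w k) ∧
      ((Finset.univ.filter fun k => w k ≠ 0).card : ℝ) ≤ 17 * Module.finrank ℝ U / ε ^ 2 ∧
      ∀ z ∈ U, (1 - ε) * ∑ k, z k ^ 2 ≤ ∑ k, w k * z k ^ 2 ∧
        ∑ k, w k * z k ^ 2 ≤ (1 + ε) * ∑ k, z k ^ 2 := by
  let b := stdOrthonormalBasis ℝ U
  let v : κ → Fin (Module.finrank ℝ U) → ℝ := fun k i => (b i : EuclideanSpace ℝ κ) k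
  have hv : ∑ k, vecMulVec (v k) (v k) = 1 := by
    ext i j
    have h := orthonormal_iff_ite.mp b.orthonormal i j
    rw [Submodule.coe_inner, PiLp.inner_apply] at h
    simpa [Matrix.sum_apply, vecMulVec_apply, one_apply, v, mul_comm] using h
  obtain ⟨w, hw, hcard, h⟩ := exists_sparse_weights_of_isotropic hv hε hε1
  refine ⟨w, hw, by simpa using hcard, fun z hz => ?_⟩
  let c := b.repr ⟨z, hz⟩
  have hzc (k : κ) : v k ⬝ᵥ c = z k := by
    have h1 := congrArg (fun x : U => (x : EuclideanSpace ℝ κ) k) (b.sum_repr ⟨z, hz⟩)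
    simpa [dotProduct, v, c, mul_comm] using h1
  have hcc : c ⬝ᵥ c = ∑ k, z k ^ 2 := by
    have h1 : ‖c‖ ^ 2 = ‖z‖ ^ 2 := by
      rw [b.repr.norm_map]; rfl
    rw [EuclideanSpace.real_norm_sq_eq, EuclideanSpace.real_norm_sq_eq] at h1
    rw [← h1]
    simp [dotProduct, sq]
  have := h c
  simpa only [hzc, hcc] using this

/-- The linear map sending `(b, β)` to the residual vector `b y − ⟨x, β⟩`. -/
noncomputable def residualMap {N T d : ℕ} (x : Fin N → Fin T → Fin d → ℝ)
    (y : Fin N → Fin T → ℝ) : ℝ × (Fin d → ℝ) →ₗ[ℝ] EuclideanSpace ℝ (Fin N × Fin T) where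
  toFun p := WithLp.toLp 2 fun k => p.1 * y k.1 k.2 - ∑ j, x k.1 k.2 j * p.2 j
  map_add' p q := by
    ext k
    simp [mul_add, add_mul, Finset.sum_add_distrib]
    ring
  map_smul' a p := by
    ext k
    simp only [Prod.smul_fst, Prod.smul_snd, smul_eq_mul, Pi.smul_apply, PiLp.smul_apply,
      RingHom.id_apply, mul_sub, Finset.mul_sum]
    congr 1
    · ring
    · exact Finset.sum_congr rfl fun j _ => by ring

/-- there is an absolute constant `C > 0` such that every panel dataset admits
an `ε`-coreset for OLSE with at most `C·d/ε²` individual-time pairs. -/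
theorem olse_eps_coreset_exists :
    ∃ C : ℝ, 0 < C ∧
      ∀ (N T d : ℕ), 1 ≤ d →
        ∀ (x : Fin N → Fin T → Fin d → ℝ) (y : Fin N → Fin T → ℝ) (ε : ℝ),
          0 < ε → ε < 1 →
          ∃ (S : Finset (Fin N × Fin T)) (w : Fin N × Fin T → ℝ),
            (S.card : ℝ) ≤ C * d / ε ^ 2 ∧
            (∀ p ∈ S, 0 ≤ w p) ∧
            ∀ β : Fin d → ℝ,
              (1 - ε) * (∑ i, ∑ t, psiO x y i t β) ≤
                  (∑ p ∈ S, w p * psiO x y p.1 p.2 β) ∧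
                (∑ p ∈ S, w p * psiO x y p.1 p.2 β) ≤
                  (1 + ε) * (∑ i, ∑ t, psiO x y i t β) := by
  refine ⟨34, by norm_num, fun N T d hd x y ε hε hε1 => ?_⟩
  obtain ⟨w, hw, hcard, h⟩ := (LinearMap.range (residualMap x y)).exists_sparse_weights hε hε1
  refine ⟨Finset.univ.filter fun k => w k ≠ 0, w, hcard.trans ?_, fun p _ => hw p, fun β => ?_⟩
  · have hrank : Module.finrank ℝ (LinearMap.range (residualMap x y)) ≤ 1 + d := by
      simpa using (residualMap x y).finrank_range_le
    have hrank' : (Module.finrank ℝ (LinearMap.range (residualMap x y)) : ℝ) ≤ 2 * d := by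
      exact_mod_cast hrank.trans (by omega)
    rw [show (34 : ℝ) * d = 17 * (2 * d) by ring]
    gcongr
  · have hβ := h _ (LinearMap.mem_range_self (residualMap x y) (1, β))
    have hfull : ∑ i, ∑ t, psiO x y i t β = ∑ k, residualMap x y (1, β) k ^ 2 := by
      rw [Fintype.sum_prod_type]
      simp [psiO, residualMap]
    have hsub : ∑ p ∈ Finset.univ.filter (fun k => w k ≠ 0), w p * psiO x y p.1 p.2 β =
        ∑ k, w k * residualMap x y (1, β) k ^ 2 := by
      rw [Finset.sum_filter_of_ne fun k _ hk => left_ne_zero_of_mul hk]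
      simp [psiO, residualMap]
    rwa [hfull, hsub]
end

section
/- Fix a panel dataset, integers q, k ≥ 1, and ε ∈ (0,1). Suppose I ⊆ [N] with weights w' : I → ℝ_{≥0} satisfies: for every ζ = (β^{(1)},…,β^{(k)},ρ^{(1)},…,ρ^{(k)}) ∈ (ℝ^d × B^q)^k, Σ_{i∈I} w'(i)·ψ^{G,q,k}_i(ζ) lies in [(1−ε/3)·ψ^{G,q,k}(ζ), (1+ε/3)·ψ^{G,q,k}(ζ)]. Suppose further that for each i ∈ I there are J_i ⊆ [T] and weights w^{(i)} : J_i → ℝ_{≥0} such that for every (β,ρ) ∈ ℝ^d × B^q, Σ_{t∈J_i} w^{(i)}(t)·ψ^{G,q}_{it}(β,ρ) lies in [(1−ε/3)·ψ^{G,q}_i(β,ρ), (1+ε/3)·ψ^{G,q}_i(β,ρ)]. Then for every ζ ∈ (ℝ^d × B^q)^k, Σ_{i∈I} w'(i) · min_{l∈[k]} Σ_{t∈J_i} w^{(i)}(t)·ψ^{G,q}_{it}(β^{(l)},ρ^{(l)}) lies in [(1−ε)·ψ^{G,q,k}(ζ), (1+ε)·ψ^{G,q,k}(ζ)]. -/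
theorem psiG_nonneg {N T d q : ℕ} (x : Fin N → Fin T → Fin d → ℝ) (y : Fin N → Fin T → ℝ)
    (i : Fin N) (t : Fin T) (β : Fin d → ℝ) {ρ : Fin q → ℝ} (hρ : ∑ a, ρ a ^ 2 ≤ 1) :
    0 ≤ psiG x y i t β ρ := by
  unfold psiG
  split_ifs
  · exact mul_nonneg (sub_nonneg.2 hρ) (sq_nonneg _)
  · exact sq_nonneg _

theorem Finset.mul_inf'_le_inf' {ι : Type*} {s : Finset ι} (hs : s.Nonempty) {f g : ι → ℝ}
    {c : ℝ} (hc : 0 ≤ c) (h : ∀ l ∈ s, c * f l ≤ g l) : c * s.inf' hs f ≤ s.inf' hs g :=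
  Finset.le_inf' _ _ fun l hl =>
    (mul_le_mul_of_nonneg_left (Finset.inf'_le f hl) hc).trans (h l hl)

theorem Finset.inf'_le_mul_inf' {ι : Type*} {s : Finset ι} (hs : s.Nonempty) {f g : ι → ℝ}
    {c : ℝ} (h : ∀ l ∈ s, g l ≤ c * f l) : s.inf' hs g ≤ c * s.inf' hs f := by
  obtain ⟨l, hl, hfl⟩ := Finset.exists_mem_eq_inf' hs f
  rw [hfl]
  exact (Finset.inf'_le g hl).trans (h l hl)

/-- two-stage composition of coresets for GLSE_k. If `I` with weights `w'` is
an `ε/3`-coreset at the individual level for the GLSE_k objective, and for each `i ∈ I` the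
set `J i` with weights `wt i` is an `ε/3`-coreset for the individual GLSE objective of `i`,
then the composed weighted set is an `ε`-coreset for GLSE_k. Queries range over
`(ℝ^d × B^q)^k` where `B^q = {ρ : ‖ρ‖₂ < 1}`. -/
theorem glsek_two_stage_coreset_composition
    (N T d q k : ℕ) (hq : 1 ≤ q) (hk : 1 ≤ k)
    (x : Fin N → Fin T → Fin d → ℝ) (y : Fin N → Fin T → ℝ)
    (ε : ℝ) (hε0 : 0 < ε) (hε1 : ε < 1)
    (I : Finset (Fin N)) (w' : Fin N → ℝ) (hw' : ∀ i ∈ I, 0 ≤ w' i)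
    (J : Fin N → Finset (Fin T)) (wt : Fin N → Fin T → ℝ)
    (hwt : ∀ i ∈ I, ∀ t ∈ J i, 0 ≤ wt i t)
    (hI : ∀ (β : Fin k → Fin d → ℝ) (ρ : Fin k → Fin q → ℝ),
      (∀ l, ∑ a, ρ l a ^ 2 < 1) →
      (1 - ε / 3) * (∑ i, Finset.univ.inf' ⟨⟨0, hk⟩, Finset.mem_univ _⟩
            (fun l => ∑ t, psiG x y i t (β l) (ρ l))) ≤
          (∑ i ∈ I, w' i * Finset.univ.inf' ⟨⟨0, hk⟩, Finset.mem_univ _⟩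
            (fun l => ∑ t, psiG x y i t (β l) (ρ l))) ∧
        (∑ i ∈ I, w' i * Finset.univ.inf' ⟨⟨0, hk⟩, Finset.mem_univ _⟩
            (fun l => ∑ t, psiG x y i t (β l) (ρ l))) ≤
          (1 + ε / 3) * (∑ i, Finset.univ.inf' ⟨⟨0, hk⟩, Finset.mem_univ _⟩
            (fun l => ∑ t, psiG x y i t (β l) (ρ l))))
    (hJ : ∀ i ∈ I, ∀ (β : Fin d → ℝ) (ρ : Fin q → ℝ), (∑ a, ρ a ^ 2 < 1) →
      (1 - ε / 3) * (∑ t, psiG x y i t β ρ) ≤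
          (∑ t ∈ J i, wt i t * psiG x y i t β ρ) ∧
        (∑ t ∈ J i, wt i t * psiG x y i t β ρ) ≤
          (1 + ε / 3) * (∑ t, psiG x y i t β ρ)) :
    ∀ (β : Fin k → Fin d → ℝ) (ρ : Fin k → Fin q → ℝ),
      (∀ l, ∑ a, ρ l a ^ 2 < 1) →
      (1 - ε) * (∑ i, Finset.univ.inf' ⟨⟨0, hk⟩, Finset.mem_univ _⟩
            (fun l => ∑ t, psiG x y i t (β l) (ρ l))) ≤
          (∑ i ∈ I, w' i * Finset.univ.inf' ⟨⟨0, hk⟩, Finset.mem_univ _⟩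
            (fun l => ∑ t ∈ J i, wt i t * psiG x y i t (β l) (ρ l))) ∧
        (∑ i ∈ I, w' i * Finset.univ.inf' ⟨⟨0, hk⟩, Finset.mem_univ _⟩
            (fun l => ∑ t ∈ J i, wt i t * psiG x y i t (β l) (ρ l))) ≤
          (1 + ε) * (∑ i, Finset.univ.inf' ⟨⟨0, hk⟩, Finset.mem_univ _⟩
            (fun l => ∑ t, psiG x y i t (β l) (ρ l))) := by
  intro β ρ hρ
  obtain ⟨hI₁, hI₂⟩ := hI β ρ hρ
  have hF : 0 ≤ ∑ i, Finset.univ.inf' ⟨⟨0, hk⟩, Finset.mem_univ _⟩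
      (fun l => ∑ t, psiG x y i t (β l) (ρ l)) :=
    Finset.sum_nonneg fun i _ => Finset.le_inf' _ _ fun l _ =>
      Finset.sum_nonneg fun t _ => psiG_nonneg x y i t (β l) (hρ l).le
  have hlower : (1 - ε / 3) * (∑ i ∈ I, w' i * Finset.univ.inf' ⟨⟨0, hk⟩, Finset.mem_univ _⟩
      (fun l => ∑ t, psiG x y i t (β l) (ρ l))) ≤
      ∑ i ∈ I, w' i * Finset.univ.inf' ⟨⟨0, hk⟩, Finset.mem_univ _⟩
        (fun l => ∑ t ∈ J i, wt i t * psiG x y i t (β l) (ρ l)) := by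
    rw [Finset.mul_sum]
    refine Finset.sum_le_sum fun i hi => ?_
    rw [mul_left_comm]
    exact mul_le_mul_of_nonneg_left (Finset.mul_inf'_le_inf' _ (by linarith)
      fun l _ => (hJ i hi (β l) (ρ l) (hρ l)).1) (hw' i hi)
  have hupper : (∑ i ∈ I, w' i * Finset.univ.inf' ⟨⟨0, hk⟩, Finset.mem_univ _⟩
        (fun l => ∑ t ∈ J i, wt i t * psiG x y i t (β l) (ρ l))) ≤
      (1 + ε / 3) * (∑ i ∈ I, w' i * Finset.univ.inf' ⟨⟨0, hk⟩, Finset.mem_univ _⟩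
        (fun l => ∑ t, psiG x y i t (β l) (ρ l))) := by
    rw [Finset.mul_sum]
    refine Finset.sum_le_sum fun i hi => ?_
    rw [mul_left_comm]
    exact mul_le_mul_of_nonneg_left (Finset.inf'_le_mul_inf' _
      fun l _ => (hJ i hi (β l) (ρ l) (hρ l)).2) (hw' i hi)
  constructor
  · refine le_trans ?_ ((mul_le_mul_of_nonneg_left hI₁ (by linarith)).trans hlower)
    rw [← mul_assoc]
    exact mul_le_mul_of_nonneg_right (by nlinarith) hF
  · refine (hupper.trans (mul_le_mul_of_nonneg_left hI₂ (by linarith))).trans ?_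
    rw [← mul_assoc]
    exact mul_le_mul_of_nonneg_right (by nlinarith) hF
end
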